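/- arXiv:2507.20769 — 7 statements merged into one kernel-verified Lean document; each statement's English description precedes it below -/
import Mathlib

section
/- Let n ≥ 1, let a, b : Fin n → ℝ with a i ≤ b i for all i, and let X = Set.Icc a b be the corresponding box with midpoint c (c i = (a i + b i)/2) and half-widths r (r i = (b i - a i)/2). Let f : ℝⁿ → ℝ be continuously differentiable, and let l, u : Fin n → ℝ be such that for every x ∈ X and every i, the partial derivative ∂f/∂x_i(x) lies in the interval [l i, u i]. Then the Mean Value Form is an inclusion function: for every x ∈ X, |f(x) − f(c)| ≤ Σ_i max(|l i|, |u i|) · r i; equivalently, f(x) ∈ [f(c) − Σ_i max(|l i|,|u i|)·r i, f(c) + Σ_i max(|l i|,|u i|)·r i]. -/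
theorem mean_value_form_inclusion
    (n : ℕ) (hn : 1 ≤ n) (a b : Fin n → ℝ) (hab : ∀ i, a i ≤ b i)
    (c r : Fin n → ℝ) (hc : ∀ i, c i = (a i + b i) / 2) (hr : ∀ i, r i = (b i - a i) / 2)
    (f : (Fin n → ℝ) → ℝ) (hf : ContDiff ℝ 1 f)
    (l u : Fin n → ℝ)
    (hlu : ∀ x ∈ Set.Icc a b, ∀ i, fderiv ℝ f x (Pi.single i 1) ∈ Set.Icc (l i) (u i)) :
    ∀ x ∈ Set.Icc a b,
      |f x - f c| ≤ ∑ i, max |l i| |u i| * r i ∧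
      f x ∈ Set.Icc (f c - ∑ i, max |l i| |u i| * r i)
                    (f c + ∑ i, max |l i| |u i| * r i) := by
  intro x hx
  have key : |f x - f c| ≤ ∑ i, max |l i| |u i| * r i := by
    have hcm : c ∈ Set.Icc a b := by
      constructor <;> intro i <;> have h1 := hab i <;> have h2 := hc i <;> linarith
    have hd : Differentiable ℝ f := hf.differentiable (by norm_num)
    obtain ⟨z, hz, hzeq⟩ := domain_mvt (f := f) (f' := fderiv ℝ f)
      (fun y _ => (hd y).hasFDerivAt.hasFDerivWithinAt) (convex_Icc a b) hcm hx
    have hzm : z ∈ Set.Icc a b := (convex_Icc a b).segment_subset hcm hx hz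
    have hexp : fderiv ℝ f z (x - c)
        = ∑ i, (x i - c i) * fderiv ℝ f z (Pi.single i 1) := by
      conv_lhs => rw [pi_eq_sum_univ' (x - c)]
      simp [map_sum, Pi.single_apply, Pi.single, Function.update_apply]
      first
        | done
        | (refine Finset.sum_congr rfl fun i _ => ?_
           congr 2)
    rw [hzeq, hexp]
    refine (Finset.abs_sum_le_sum_abs _ _).trans (Finset.sum_le_sum fun i _ => ?_)
    rw [abs_mul, mul_comm]
    refine mul_le_mul ?_ ?_ (abs_nonneg _) ((abs_nonneg _).trans (le_max_left _ _))
    · exact abs_le_max_abs_abs (hlu z hzm i).1 (hlu z hzm i).2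
    · have h1 := hx.1 i
      have h2 := hx.2 i
      have h3 := hc i
      have h4 := hr i
      rw [abs_le]
      constructor <;> linarith
  refine ⟨key, ?_⟩
  have h := abs_le.mp key
  constructor <;> linarith [h.1, h.2]
end

section
/- Let f : ℝ → ℝ be differentiable with derivative f' that is L-Lipschitz on [a, b] (a ≤ b), let c = (a+b)/2 and M = sup_{x ∈ [a,b]} |f'(x)|. Then (i) f([a,b]) ⊆ [f(c) − M·(b−a)/2, f(c) + M·(b−a)/2], and (ii) the excess width of this Mean Value Form enclosure is at most quadratic in the domain width: M·(b−a) − (sup_{[a,b]} f − inf_{[a,b]} f) ≤ L·(b−a)². -/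
theorem mean_value_form_univariate_inclusion_and_excess_width
    (f : ℝ → ℝ) (hf : Differentiable ℝ f) (a b : ℝ) (hab : a ≤ b) (L : ℝ)
    (hL : ∀ x ∈ Set.Icc a b, ∀ y ∈ Set.Icc a b, |deriv f x - deriv f y| ≤ L * |x - y|)
    (c M : ℝ) (hc : c = (a + b) / 2)
    (hM : M = sSup ((fun x => |deriv f x|) '' Set.Icc a b)) :
    (∀ x ∈ Set.Icc a b, f x ∈ Set.Icc (f c - M * (b - a) / 2) (f c + M * (b - a) / 2)) ∧
    M * (b - a) - (sSup (f '' Set.Icc a b) - sInf (f '' Set.Icc a b)) ≤ L * (b - a) ^ 2 := by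
  rcases hab.eq_or_lt with rfl | hlt
  · have hca : c = a := by rw [hc]; ring
    subst hca
    simp
  have hL0 : 0 ≤ L := by
    have h := hL a ⟨le_rfl, hab⟩ b ⟨hab, le_rfl⟩
    have h1 : 0 ≤ L * |a - b| := (abs_nonneg _).trans h
    exact nonneg_of_mul_nonneg_left h1 (abs_pos.2 (by linarith))
  have key : ∀ y ∈ Set.Icc a b, ∀ x ∈ Set.Icc a b,
      |deriv f x| ≤ |deriv f y| + L * (b - a) := by
    intro y hy x hx
    have h := hL x hx y hy
    have h1 : |x - y| ≤ b - a := abs_le.2 ⟨by linarith [hx.1, hy.2], by linarith [hx.2, hy.1]⟩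
    have h2 := mul_le_mul_of_nonneg_left h1 hL0
    have h3 := abs_sub_abs_le_abs_sub (deriv f x) (deriv f y)
    linarith
  have ha : a ∈ Set.Icc a b := ⟨le_rfl, hab⟩
  have hb : b ∈ Set.Icc a b := ⟨hab, le_rfl⟩
  have hbdd : BddAbove ((fun x => |deriv f x|) '' Set.Icc a b) := by
    refine ⟨|deriv f a| + L * (b - a), ?_⟩
    rintro _ ⟨x, hx, rfl⟩
    exact key a ha x hx
  have hMx : ∀ x ∈ Set.Icc a b, |deriv f x| ≤ M := fun x hx => by
    rw [hM]; exact le_csSup hbdd ⟨x, hx, rfl⟩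
  have hM0 : 0 ≤ M := (abs_nonneg _).trans (hMx a ha)
  constructor
  · intro x hx
    have hcm : c ∈ Set.Icc a b := ⟨by linarith, by linarith⟩
    have h := (convex_Icc a b).norm_image_sub_le_of_norm_deriv_le
      (f := f) (C := M) (fun x _ => hf x) hMx hcm hx
    rw [Real.norm_eq_abs, Real.norm_eq_abs] at h
    have h1 : |x - c| ≤ (b - a) / 2 := abs_le.2 ⟨by linarith [hx.1], by linarith [hx.2]⟩
    have h2 := mul_le_mul_of_nonneg_left h1 hM0
    have h3 := abs_le.1 (h.trans h2)
    constructor <;> linarith [h3.1, h3.2]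
  · obtain ⟨ξ, hξ, he⟩ := exists_deriv_eq_slope f hlt hf.continuous.continuousOn
      hf.differentiableOn
    have hMξ : M ≤ |deriv f ξ| + L * (b - a) := by
      rw [hM]
      apply csSup_le (Set.Nonempty.image _ ⟨a, ha⟩)
      rintro _ ⟨x, hx, rfl⟩
      exact key ξ (Set.Ioo_subset_Icc_self hξ) x hx
    have hpos : 0 < b - a := by linarith
    have hab' : |deriv f ξ| * (b - a) = |f b - f a| := by
      rw [he, abs_div, abs_of_pos hpos]; field_simp
    have hcpt := (isCompact_Icc (a := a) (b := b)).image hf.continuous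
    have s1 := le_csSup hcpt.bddAbove ⟨a, ha, rfl⟩
    have s2 := le_csSup hcpt.bddAbove ⟨b, hb, rfl⟩
    have i1 := csInf_le hcpt.bddBelow ⟨a, ha, rfl⟩
    have i2 := csInf_le hcpt.bddBelow ⟨b, hb, rfl⟩
    have hw : |f b - f a| ≤ sSup (f '' Set.Icc a b) - sInf (f '' Set.Icc a b) :=
      abs_le.2 ⟨by linarith, by linarith⟩
    have h2 := mul_le_mul_of_nonneg_right hMξ hpos.le
    nlinarith
end

section
/- Let n ≥ 1, let a, b : Fin n → ℝ with a i ≤ b i for all i, and let Y = Set.Icc a b be the corresponding box with midpoint c, half-widths r (r i = (b i − a i)/2), and width w(Y) = max_i (b i − a i). Let f : ℝⁿ → ℝ be continuously differentiable with partial derivatives satisfying |∂f/∂x_i(x) − ∂f/∂x_i(y)| ≤ L·max_j |x j − y j| for all x, y ∈ Y and all i. Set M i = sup_{y ∈ Y} |∂f/∂x_i(y)|. Then the Mean Value Form with exact derivative ranges has excess width of second order: 2·Σ_i M i · r i − (sup_Y f − inf_Y f) ≤ n·L·w(Y)². -/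
theorem mean_value_form_excess_width_second_order
    (n : ℕ) (hn : 1 ≤ n) (a b : Fin n → ℝ) (hab : ∀ i, a i ≤ b i)
    (f : (Fin n → ℝ) → ℝ) (hf : ContDiff ℝ 1 f) (L : ℝ)
    (hL : ∀ x ∈ Set.Icc a b, ∀ y ∈ Set.Icc a b, ∀ i,
      |fderiv ℝ f x (Pi.single i 1) - fderiv ℝ f y (Pi.single i 1)| ≤ L * ⨆ j, |x j - y j|)
    (r M : Fin n → ℝ) (hr : ∀ i, r i = (b i - a i) / 2)
    (hM : ∀ i, M i = sSup ((fun y => |fderiv ℝ f y (Pi.single i 1)|) '' Set.Icc a b))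
    (w : ℝ) (hw : w = ⨆ i, (b i - a i)) :
    2 * ∑ i, M i * r i - (sSup (f '' Set.Icc a b) - sInf (f '' Set.Icc a b))
      ≤ (n : ℝ) * L * w ^ 2 := by
  have i0 : Fin n := ⟨0, hn⟩
  haveI : Nonempty (Fin n) := ⟨i0⟩
  have haI : a ∈ Set.Icc a b := ⟨le_refl _, hab⟩
  have hbI : b ∈ Set.Icc a b := ⟨hab, le_refl _⟩
  by_cases hL0 : L < 0
  · have h1 := (abs_nonneg _).trans (hL a haI b hbI i0)
    have h2 : (⨆ j, |a j - b j|) ≤ 0 := by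
      by_contra h
      push Not at h
      nlinarith
    have h3 : b = a := by
      funext j
      have h4 : |a j - b j| ≤ ⨆ j, |a j - b j| :=
        le_ciSup (f := fun j => |a j - b j|) (Set.finite_range _).bddAbove j
      have h5 := abs_nonpos_iff.1 (h4.trans h2)
      linarith
    subst h3
    have h6 : ∀ i, r i = 0 := fun i => by simp [hr]
    simp [h6, hw]
  push Not at hL0
  have hwi : ∀ i, b i - a i ≤ w := fun i => by
    rw [hw]
    exact le_ciSup (f := fun j => b j - a j) (Set.finite_range _).bddAbove i
  have hr0 : ∀ i, 0 ≤ r i := fun i => by rw [hr]; linarith [hab i]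
  have hrw : ∀ i, r i ≤ w / 2 := fun i => by rw [hr]; linarith [hwi i]
  have hw0 : 0 ≤ w := by linarith [hwi i0, hab i0]
  set c : Fin n → ℝ := fun i => (a i + b i) / 2 with hc
  have hcI : c ∈ Set.Icc a b :=
    ⟨fun i => by simp only [hc]; linarith [hab i], fun i => by simp only [hc]; linarith [hab i]⟩
  have hkey : ∀ y ∈ Set.Icc a b, ∀ i,
      |fderiv ℝ f y (Pi.single i 1) - fderiv ℝ f c (Pi.single i 1)| ≤ L * (w / 2) := by
    intro y hy i
    refine (hL y hy c hcI i).trans (mul_le_mul_of_nonneg_left (ciSup_le fun j => ?_) hL0)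
    have h1 := hy.1 j
    have h2 := hy.2 j
    have h3 := hwi j
    simp only [hc]
    rw [abs_le]
    constructor <;> linarith
  have hMle : ∀ i, M i ≤ |fderiv ℝ f c (Pi.single i 1)| + L * (w / 2) := by
    intro i
    rw [hM]
    refine csSup_le ⟨_, Set.mem_image_of_mem _ hcI⟩ ?_
    rintro _ ⟨y, hy, rfl⟩
    have h1 := hkey y hy i
    have h2 := abs_sub_abs_le_abs_sub (fderiv ℝ f y (Pi.single i 1)) (fderiv ℝ f c (Pi.single i 1))
    simp only
    linarith
  obtain ⟨s, hs⟩ : ∃ s : Fin n → ℝ, ∀ i, |s i| ≤ 1 ∧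
      s i * fderiv ℝ f c (Pi.single i 1) = |fderiv ℝ f c (Pi.single i 1)| := by
    refine ⟨fun i => if 0 ≤ fderiv ℝ f c (Pi.single i 1) then 1 else -1, fun i => ?_⟩
    by_cases h : 0 ≤ fderiv ℝ f c (Pi.single i 1)
    · simp [h, abs_of_nonneg h]
    · simp [h, abs_of_neg (not_le.1 h)]
  set v : Fin n → ℝ := fun i => s i * r i with hv
  have hmem : ∀ t : ℝ, |t| ≤ 1 → c + t • v ∈ Set.Icc a b := by
    intro t ht
    have hb : ∀ i, |t * (s i * r i)| ≤ r i := fun i => by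
      rw [abs_mul, abs_mul, abs_of_nonneg (hr0 i)]
      have := mul_le_one₀ ht (abs_nonneg _) (hs i).1
      nlinarith [hr0 i]
    constructor <;> intro i <;> have h1 := abs_le.1 (hb i) <;> rw [hr i] at h1 <;>
      simp only [hc, hv, Pi.add_apply, Pi.smul_apply, smul_eq_mul] <;> rw [hr i] <;>
      linarith [h1.1, h1.2]
  have hd : ∀ t : ℝ, HasDerivAt (fun t : ℝ => f (c + t • v)) (fderiv ℝ f (c + t • v) v) t := by
    intro t
    have h1 : HasDerivAt (fun t : ℝ => c + t • v) v t := by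
      simpa using ((hasDerivAt_id t).smul_const v).const_add c
    exact ((hf.differentiable one_ne_zero) (c + t • v)).hasFDerivAt.comp_hasDerivAt t h1
  obtain ⟨t, ht, hteq⟩ := exists_hasDerivAt_eq_slope (fun t : ℝ => f (c + t • v))
    (fun t => fderiv ℝ f (c + t • v) v) (a := -1) (b := 1) (by norm_num)
    (fun t _ => (hd t).continuousAt.continuousWithinAt) (fun t _ => hd t)
  have htI := hmem t (abs_le.2 ⟨ht.1.le, ht.2.le⟩)
  have hcomp : IsCompact (f '' Set.Icc a b) := isCompact_Icc.image hf.continuous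
  have hsup := le_csSup hcomp.bddAbove (Set.mem_image_of_mem f (hmem 1 (by simp)))
  have hinf := csInf_le hcomp.bddBelow (Set.mem_image_of_mem f (hmem (-1) (by simp)))
  have hsum : fderiv ℝ f (c + t • v) v
      = ∑ i, v i * fderiv ℝ f (c + t • v) (Pi.single i 1) := by
    conv_lhs => rw [pi_eq_sum_univ' v, map_sum]
    refine Finset.sum_congr rfl fun i _ => ?_
    rw [map_smul, smul_eq_mul]
    congr 3
    ext j
    simp [Pi.single_apply, eq_comm]
  have hmain : ∑ i, M i * r i - ∑ i, v i * fderiv ℝ f (c + t • v) (Pi.single i 1)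
      ≤ (n : ℝ) * (L * w ^ 2 / 2) := by
    rw [← Finset.sum_sub_distrib]
    have : ∀ i ∈ (Finset.univ : Finset (Fin n)),
        M i * r i - v i * fderiv ℝ f (c + t • v) (Pi.single i 1) ≤ L * w ^ 2 / 2 := by
      intro i _
      have h1 := hkey _ htI i
      have h2 := hMle i
      obtain ⟨h3, h4⟩ := hs i
      set g := fderiv ℝ f c (Pi.single i 1)
      set g' := fderiv ℝ f (c + t • v) (Pi.single i 1)
      have h5 : |s i * (g' - g)| ≤ L * (w / 2) := by
        rw [abs_mul]
        nlinarith [abs_nonneg (g' - g)]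
      have h6 := (abs_le.1 h5).1
      have h7 : M i - s i * g' ≤ L * w := by nlinarith
      have h8 : 0 ≤ L * w := mul_nonneg hL0 hw0
      calc M i * r i - v i * g' = (M i - s i * g') * r i := by simp only [hv]; ring
        _ ≤ L * w * r i := mul_le_mul_of_nonneg_right h7 (hr0 i)
        _ ≤ L * w * (w / 2) := mul_le_mul_of_nonneg_left (hrw i) h8
        _ = _ := by ring
    simpa using Finset.sum_le_sum this
  rw [← hsum, hteq] at hmain
  linarith
end

section
/- Let n ≥ 1, let a, b : Fin n → ℝ with a i ≤ b i for all i, and let Y = Set.Icc a b be the corresponding box with midpoint c, half-widths r (r i = (b i − a i)/2), and width w(Y) = max_i (b i − a i). Let f : ℝⁿ → ℝ be continuously differentiable with partial derivatives satisfying |∂f/∂x_i(x) − ∂f/∂x_i(y)| ≤ L·max_j |x j − y j| for all x, y ∈ Y and all i, and set M i = sup_{y ∈ Y} |∂f/∂x_i(y)|. Then the lower endpoint of the Mean Value Form underestimates the true minimum by at most a second-order amount: 0 ≤ inf_Y f − (f(c) − Σ_i M i · r i) ≤ (1/2)·n·L·w(Y)². -/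
theorem mean_value_form_lower_endpoint_second_order
    (n : ℕ) (hn : 1 ≤ n) (a b : Fin n → ℝ) (hab : ∀ i, a i ≤ b i)
    (f : (Fin n → ℝ) → ℝ) (hf : ContDiff ℝ 1 f) (L : ℝ)
    (hL : ∀ x ∈ Set.Icc a b, ∀ y ∈ Set.Icc a b, ∀ i,
      |fderiv ℝ f x (Pi.single i 1) - fderiv ℝ f y (Pi.single i 1)| ≤ L * ⨆ j, |x j - y j|)
    (c r M : Fin n → ℝ) (hc : ∀ i, c i = (a i + b i) / 2) (hr : ∀ i, r i = (b i - a i) / 2)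
    (hM : ∀ i, M i = sSup ((fun y => |fderiv ℝ f y (Pi.single i 1)|) '' Set.Icc a b))
    (w : ℝ) (hw : w = ⨆ i, (b i - a i)) :
    0 ≤ sInf (f '' Set.Icc a b) - (f c - ∑ i, M i * r i) ∧
    sInf (f '' Set.Icc a b) - (f c - ∑ i, M i * r i) ≤ (1 / 2) * (n : ℝ) * L * w ^ 2 := by
  have : Nonempty (Fin n) := ⟨⟨0, hn⟩⟩
  have hle : a ≤ b := hab
  have haY : a ∈ Set.Icc a b := ⟨le_refl _, hle⟩
  have hbY : b ∈ Set.Icc a b := ⟨hle, le_refl _⟩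
  have hcY : c ∈ Set.Icc a b := by
    constructor <;> intro i <;> rw [hc] <;> linarith [hab i]
  have hr0 : ∀ i, 0 ≤ r i := fun i => by rw [hr]; linarith [hab i]
  have hwi : ∀ i, b i - a i ≤ w := fun i => by
    rw [hw]; exact le_ciSup (f := fun i => b i - a i) (Set.finite_range _).bddAbove i
  have hw0 : 0 ≤ w := le_trans (by linarith [hab ⟨0, hn⟩]) (hwi ⟨0, hn⟩)
  have hrw : ∀ i, r i ≤ w / 2 := fun i => by rw [hr]; linarith [hwi i]
  have hLw : 0 ≤ L * w := by
    have h := hL b hbY a haY ⟨0, hn⟩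
    have e : (⨆ j, |b j - a j|) = w := by
      rw [hw]; congr 1; ext j; exact abs_of_nonneg (by linarith [hab j])
    rw [e] at h
    exact (abs_nonneg _).trans h
  have hyc : ∀ y ∈ Set.Icc a b, ∀ i, |y i - c i| ≤ r i := by
    intro y hy i
    rw [abs_le, hc, hr]
    constructor <;> linarith [hy.1 i, hy.2 i]
  have hgc : ∀ y ∈ Set.Icc a b, ∀ i,
      |fderiv ℝ f y (Pi.single i 1) - fderiv ℝ f c (Pi.single i 1)| ≤ L * w / 2 := by
    intro y hy i
    refine (hL y hy c hcY i).trans ?_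
    have h1 : (⨆ j, |y j - c j|) ≤ w / 2 := ciSup_le fun j => (hyc y hy j).trans (hrw j)
    have h0 : 0 ≤ ⨆ j, |y j - c j| := Real.iSup_nonneg fun j => abs_nonneg _
    rcases le_or_gt 0 L with h | h
    · nlinarith [mul_le_mul_of_nonneg_left h1 h]
    · nlinarith [mul_nonneg (neg_nonneg.2 h.le) h0]
  have hmvt : ∀ y ∈ Set.Icc a b, ∃ z ∈ Set.Icc a b,
      f y - f c = ∑ i, (y i - c i) * fderiv ℝ f z (Pi.single i 1) := by
    intro y hy
    obtain ⟨z, hz, h⟩ := domain_mvt (f := f) (f' := fun x => fderiv ℝ f x) (s := Set.Icc a b)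
      (fun x _ => ((hf.differentiable (by norm_num)) x).hasFDerivAt.hasFDerivWithinAt)
      (convex_Icc a b) hcY hy
    refine ⟨z, (convex_Icc a b).segment_subset hcY hy hz, ?_⟩
    rw [h]
    conv_lhs => rw [pi_eq_sum_univ' (y - c)]
    simp only [map_sum, map_smul, smul_eq_mul, Pi.sub_apply]
  have hcont : ∀ i, Continuous fun y => |fderiv ℝ f y (Pi.single i 1)| := fun i =>
    ((hf.continuous_fderiv (by norm_num)).clm_apply continuous_const).abs
  have hgM : ∀ y ∈ Set.Icc a b, ∀ i, |fderiv ℝ f y (Pi.single i 1)| ≤ M i := by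
    intro y hy i
    rw [hM]
    exact le_csSup (isCompact_Icc.image (hcont i)).bddAbove ⟨y, hy, rfl⟩
  have hMc : ∀ i, M i ≤ |fderiv ℝ f c (Pi.single i 1)| + L * w / 2 := by
    intro i
    rw [hM]
    refine csSup_le ⟨_, c, hcY, rfl⟩ ?_
    rintro _ ⟨y, hy, rfl⟩
    have h1 := hgc y hy i
    have h2 := abs_sub_abs_le_abs_sub (fderiv ℝ f y (Pi.single i 1)) (fderiv ℝ f c (Pi.single i 1))
    show |fderiv ℝ f y (Pi.single i 1)| ≤ _
    linarith
  constructor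
  · rw [sub_nonneg]
    refine le_csInf ⟨_, c, hcY, rfl⟩ ?_
    rintro _ ⟨y, hy, rfl⟩
    obtain ⟨z, hz, h⟩ := hmvt y hy
    have : -∑ i, M i * r i ≤ f y - f c := by
      rw [h, ← Finset.sum_neg_distrib]
      refine Finset.sum_le_sum fun i _ => ?_
      have h1 := neg_abs_le ((y i - c i) * fderiv ℝ f z (Pi.single i 1))
      rw [abs_mul] at h1
      have h2 := mul_le_mul (hyc y hy i) (hgM z hz i) (abs_nonneg _) (hr0 i)
      linarith
    linarith
  · let y : Fin n → ℝ := fun i =>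
      if 0 ≤ fderiv ℝ f c (Pi.single i 1) then c i - r i else c i + r i
    have hy : y ∈ Set.Icc a b := by
      constructor <;> intro i <;> simp only [y] <;> split_ifs <;> rw [hc, hr] <;>
        linarith [hab i]
    obtain ⟨z, hz, h⟩ := hmvt y hy
    have hinf : sInf (f '' Set.Icc a b) ≤ f y :=
      csInf_le (isCompact_Icc.image hf.continuous).bddBelow ⟨y, hy, rfl⟩
    have hs : f y - f c + ∑ i, M i * r i ≤ ∑ i : Fin n, L * w ^ 2 / 2 := by
      rw [h, ← Finset.sum_add_distrib]
      refine Finset.sum_le_sum fun i _ => ?_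
      have h1 := abs_le.1 (hgc z hz i)
      have h2 := mul_le_mul_of_nonneg_right (hMc i) (hr0 i)
      have h3 := mul_le_mul_of_nonneg_left (hrw i) hLw
      simp only [y]
      split_ifs with hg
      · rw [abs_of_nonneg hg] at h2
        have h4 := mul_le_mul_of_nonneg_right h1.1 (hr0 i)
        nlinarith
      · rw [abs_of_neg (not_le.1 hg)] at h2
        have h4 := mul_le_mul_of_nonneg_right h1.2 (hr0 i)
        nlinarith
    rw [Finset.sum_const, Finset.card_univ, Fintype.card_fin, nsmul_eq_mul] at hs
    linarith
end

section
/- Let n ≥ 1, N ≥ 1, let a, b : Fin n → ℝ with a i ≤ b i for all i, set X = Set.Icc a b and w(X) = max_i (b i − a i), and let X_j for j : Fin n → Fin N be the boxes of the uniform partition of X with N subintervals per dimension. Let f : ℝⁿ → ℝ be continuous, let K ≥ 0, and let l, u : (Fin n → Fin N) → ℝ be enclosures with first-order excess width: for every j, l j ≤ f(x) ≤ u j for all x ∈ X_j, and (u j − l j) − (sup_{X_j} f − inf_{X_j} f) ≤ K·w(X)/N. Then the refinement F_(N)(X) = [min_j l j, max_j u j] satisfies f(X) ⊆ F_(N)(X),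 and its excess width obeys the first-order bound (max_j u j − min_j l j) − (sup_X f − inf_X f) ≤ 2·K·w(X)/N. -/
/-- Left endpoints of the subbox of the uniform partition of `Set.Icc a b`
with `N` subintervals per dimension, indexed by the multi-index `j`. -/
noncomputable def uniformSubLo (n N : ℕ) (a b : Fin n → ℝ) (j : Fin n → Fin N) : Fin n → ℝ :=
  fun i => a i + ((j i : ℕ) : ℝ) * (b i - a i) / N

/-- Right endpoints of the subbox of the uniform partition of `Set.Icc a b`
with `N` subintervals per dimension, indexed by the multi-index `j`. -/
noncomputable def uniformSubHi (n N : ℕ) (a b : Fin n → ℝ) (j : Fin n → Fin N) : Fin n → ℝ :=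
  fun i => a i + (((j i : ℕ) : ℝ) + 1) * (b i - a i) / N

theorem exists_cell (N : ℕ) (hN : 1 ≤ N) (a b x : ℝ) (h1 : a ≤ x) (h2 : x ≤ b) :
    ∃ k : Fin N, a + ((k : ℕ) : ℝ) * (b - a) / N ≤ x ∧
      x ≤ a + (((k : ℕ) : ℝ) + 1) * (b - a) / N := by
  have hNp : (0 : ℝ) < N := by exact_mod_cast hN
  rcases eq_or_lt_of_le (h1.trans h2) with h | h
  · refine ⟨⟨0, hN⟩, ?_, ?_⟩
    · simpa using h1
    · rw [h]; simpa using h2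
  have hd : 0 < b - a := sub_pos.mpr h
  rcases eq_or_lt_of_le h2 with hx | hx
  · refine ⟨⟨N - 1, by omega⟩, ?_, ?_⟩
    · have : (((N - 1 : ℕ) : ℝ)) * (b - a) / N ≤ b - a := by
        rw [div_le_iff₀ hNp, mul_comm]
        exact mul_le_mul_of_nonneg_left (by exact_mod_cast Nat.sub_le N 1) hd.le
      simp only
      linarith
    · have h3 : (((N - 1 : ℕ) : ℝ)) + 1 = N := by
        exact_mod_cast Nat.sub_add_cancel hN
      simp only [h3]
      rw [mul_div_cancel_left₀ _ hNp.ne']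
      linarith
  · have ht0 : 0 ≤ (x - a) * N / (b - a) :=
      div_nonneg (mul_nonneg (by linarith) hNp.le) hd.le
    have htN : (x - a) * N / (b - a) < N := by
      rw [div_lt_iff₀ hd, mul_comm]
      exact mul_lt_mul_of_pos_left (by linarith) hNp
    refine ⟨⟨⌊(x - a) * N / (b - a)⌋₊, (Nat.floor_lt ht0).mpr htN⟩, ?_, ?_⟩
    · have h3 := Nat.floor_le ht0
      rw [le_div_iff₀ hd] at h3
      have := (div_le_iff₀ hNp).mpr h3
      simp only
      linarith
    · have h3 := (Nat.lt_floor_add_one ((x - a) * N / (b - a))).le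
      rw [div_le_iff₀ hd] at h3
      have := (le_div_iff₀ hNp).mpr h3
      simp only
      linarith

theorem refinement_excess_width_first_order
    (n N : ℕ) (hn : 1 ≤ n) (hN : 1 ≤ N) (a b : Fin n → ℝ) (hab : ∀ i, a i ≤ b i)
    (w : ℝ) (hw : w = ⨆ i, (b i - a i))
    (f : (Fin n → ℝ) → ℝ) (hf : Continuous f) (K : ℝ) (hK : 0 ≤ K)
    (l u : (Fin n → Fin N) → ℝ)
    (hlu : ∀ j, ∀ x ∈ Set.Icc (uniformSubLo n N a b j) (uniformSubHi n N a b j),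
      l j ≤ f x ∧ f x ≤ u j)
    (hexcess : ∀ j, (u j - l j) -
        (sSup (f '' Set.Icc (uniformSubLo n N a b j) (uniformSubHi n N a b j)) -
          sInf (f '' Set.Icc (uniformSubLo n N a b j) (uniformSubHi n N a b j)))
      ≤ K * w / N) :
    (∀ x ∈ Set.Icc a b, (⨅ j, l j) ≤ f x ∧ f x ≤ ⨆ j, u j) ∧
    ((⨆ j, u j) - ⨅ j, l j) - (sSup (f '' Set.Icc a b) - sInf (f '' Set.Icc a b))
      ≤ 2 * K * w / N := by
  have hNp : (0 : ℝ) < N := by exact_mod_cast hN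
  haveI : Nonempty (Fin N) := ⟨⟨0, hN⟩⟩
  have hbu : BddAbove (Set.range u) := (Set.finite_range u).bddAbove
  have hbl : BddBelow (Set.range l) := (Set.finite_range l).bddBelow
  have hc : IsCompact (f '' Set.Icc a b) := isCompact_Icc.image hf
  have hd : ∀ i, 0 ≤ b i - a i := fun i => sub_nonneg.mpr (hab i)
  have hle : ∀ j, uniformSubLo n N a b j ≤ uniformSubHi n N a b j := by
    intro j i
    simp only [uniformSubLo, uniformSubHi]
    have := hd i
    gcongr
    linarith
  have hsub : ∀ j, Set.Icc (uniformSubLo n N a b j) (uniformSubHi n N a b j) ⊆ Set.Icc a b := by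
    intro j
    apply Set.Icc_subset_Icc
    · intro i
      have : 0 ≤ ((j i : ℕ) : ℝ) * (b i - a i) / N :=
        div_nonneg (mul_nonneg (Nat.cast_nonneg _) (hd i)) hNp.le
      simp only [uniformSubLo]
      linarith
    · intro i
      have : (((j i : ℕ) : ℝ) + 1) * (b i - a i) / N ≤ b i - a i := by
        rw [div_le_iff₀ hNp, mul_comm]
        exact mul_le_mul_of_nonneg_left (by exact_mod_cast (j i).isLt) (hd i)
      simp only [uniformSubHi]
      linarith
  have key : ∀ j, u j ≤ sSup (f '' Set.Icc a b) + K * w / N ∧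
      sInf (f '' Set.Icc a b) - K * w / N ≤ l j := by
    intro j
    have hne : (f '' Set.Icc (uniformSubLo n N a b j) (uniformSubHi n N a b j)).Nonempty :=
      (Set.nonempty_Icc.mpr (hle j)).image f
    have h1 : sSup (f '' Set.Icc (uniformSubLo n N a b j) (uniformSubHi n N a b j)) ≤ u j := by
      apply csSup_le hne
      rintro _ ⟨x, hx, rfl⟩
      exact (hlu j x hx).2
    have h2 : l j ≤ sInf (f '' Set.Icc (uniformSubLo n N a b j) (uniformSubHi n N a b j)) := by
      apply le_csInf hne
      rintro _ ⟨x, hx, rfl⟩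
      exact (hlu j x hx).1
    have h3 := csSup_le_csSup hc.bddAbove hne (Set.image_mono (f := f) (hsub j))
    have h4 := csInf_le_csInf hc.bddBelow hne (Set.image_mono (f := f) (hsub j))
    have h5 := hexcess j
    constructor <;> linarith
  constructor
  · intro x hx
    choose j hj using fun i => exists_cell N hN (a i) (b i) (x i) (hx.1 i) (hx.2 i)
    have h := hlu j x ⟨fun i => (hj i).1, fun i => (hj i).2⟩
    exact ⟨(ciInf_le hbl j).trans h.1, h.2.trans (le_ciSup hbu j)⟩
  · have h1 : (⨆ j, u j) ≤ sSup (f '' Set.Icc a b) + K * w / N := ciSup_le fun j => (key j).1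
    have h2 : sInf (f '' Set.Icc a b) - K * w / N ≤ ⨅ j, l j := le_ciInf fun j => (key j).2
    have h3 : 2 * K * w / N = K * w / N + K * w / N := by ring
    linarith
end

section
/- Let n ≥ 1, N ≥ 1, let a, b : Fin n → ℝ with a i ≤ b i for all i, set X = Set.Icc a b and w(X) = max_i (b i − a i). Let f : ℝⁿ → ℝ be continuously differentiable with partial derivatives satisfying |∂f/∂x_i(x) − ∂f/∂x_i(y)| ≤ L·max_j |x j − y j| for all x, y ∈ X and all i. For each multi-index j : Fin n → Fin N let X_j be the corresponding box of the uniform partition, with midpoint c_j, half-widths r_j i = (b i − a i)/(2N), and M_j i = sup_{x ∈ X_j} |∂f/∂x_i(x)|, and define lo_j = f(c_j) − Σ_i M_j i · r_j i and hi_j = f(c_j) + Σ_i M_j i · r_j i. Then the refinement F_(N)(X) = [min_j lo_j, max_j hi_j] satisfies f(X) ⊆ F_(N)(X), and its excess width obeys the second-order bound (max_j hi_j − min_j lo_j) − (sup_X f − inf_X f) ≤ 2·n·L·(w(X)/N)². -/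
theorem aux_cover (α d x : ℝ) (hx : α ≤ x) (m : ℕ) (h : x ≤ α + ((m : ℝ) + 1) * d) :
    ∃ k : ℕ, k < m + 1 ∧ α + (k : ℝ) * d ≤ x ∧ x ≤ α + ((k : ℝ) + 1) * d := by
  induction m with
  | zero => exact ⟨0, by omega, by simpa using hx, by simpa using h⟩
  | succ m ih =>
    by_cases h2 : x ≤ α + ((m : ℝ) + 1) * d
    · obtain ⟨k, hk, h3⟩ := ih h2
      exact ⟨k, by omega, h3⟩
    · exact ⟨m + 1, by omega, by push_cast; linarith, by simpa using h⟩

theorem aux_mvt {n : ℕ} (f : (Fin n → ℝ) → ℝ) (hf : ContDiff ℝ 1 f) (S : Set (Fin n → ℝ))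
    (hS : Convex ℝ S) (x c : Fin n → ℝ) (hx : x ∈ S) (hc : c ∈ S) :
    ∃ z ∈ S, f x - f c = ∑ i, (x i - c i) * fderiv ℝ f z (Pi.single i 1) := by
  have hd : Differentiable ℝ f := hf.differentiable (by norm_num)
  obtain ⟨z, hz, h⟩ := domain_mvt (f := f) (f' := fun x => fderiv ℝ f x) (s := S)
    (fun y _ => (hd y).hasFDerivAt.hasFDerivWithinAt) hS hc hx
  refine ⟨z, hS.segment_subset hc hx hz, ?_⟩
  rw [h]
  have := LinearMap.pi_apply_eq_sum_univ (fderiv ℝ f z).toLinearMap (x - c)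
  simp only [ContinuousLinearMap.coe_coe, Pi.sub_apply, smul_eq_mul] at this
  rw [this]
  refine Finset.sum_congr rfl fun i _ => ?_
  congr 2
  ext k
  simp [Pi.single_apply, eq_comm]

theorem aux_upper {n : ℕ} (f : (Fin n → ℝ) → ℝ) (hf : ContDiff ℝ 1 f)
    (l u c r M : Fin n → ℝ) (hl : ∀ i, l i = c i - r i) (hu : ∀ i, u i = c i + r i)
    (hr : ∀ i, 0 ≤ r i)
    (hM : ∀ i, ∀ x ∈ Set.Icc l u, |fderiv ℝ f x (Pi.single i 1)| ≤ M i)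
    (x : Fin n → ℝ) (hx : x ∈ Set.Icc l u) :
    |f x - f c| ≤ ∑ i, M i * r i := by
  have hc : c ∈ Set.Icc l u :=
    ⟨fun i => by rw [hl]; linarith [hr i], fun i => by rw [hu]; linarith [hr i]⟩
  obtain ⟨z, hz, h⟩ := aux_mvt f hf _ (convex_Icc l u) x c hx hc
  rw [h]
  refine (Finset.abs_sum_le_sum_abs _ _).trans (Finset.sum_le_sum fun i _ => ?_)
  rw [abs_mul, mul_comm]
  have h1 : |x i - c i| ≤ r i := by
    have h1 := hx.1 i
    have h2 := hx.2 i
    rw [hl] at h1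
    rw [hu] at h2
    rw [abs_le]; constructor <;> linarith
  exact mul_le_mul (hM i z hz) h1 (abs_nonneg _) ((abs_nonneg _).trans (hM i z hz))

theorem aux_lower {n : ℕ} (f : (Fin n → ℝ) → ℝ) (hf : ContDiff ℝ 1 f)
    (l u c r M : Fin n → ℝ) (hl : ∀ i, l i = c i - r i) (hu : ∀ i, u i = c i + r i)
    (hr : ∀ i, 0 ≤ r i) (K : ℝ)
    (hK : ∀ i, ∀ x ∈ Set.Icc l u,
      |fderiv ℝ f x (Pi.single i 1) - fderiv ℝ f c (Pi.single i 1)| ≤ K)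
    (hM : ∀ i, M i ≤ |fderiv ℝ f c (Pi.single i 1)| + K)
    (σ : ℝ) (hσ : σ = 1 ∨ σ = -1) :
    ∃ x ∈ Set.Icc l u, ∑ i, M i * r i - ∑ i, 2 * K * r i ≤ σ * (f x - f c) := by
  have hc : c ∈ Set.Icc l u :=
    ⟨fun i => by rw [hl]; linarith [hr i], fun i => by rw [hu]; linarith [hr i]⟩
  have key : ∀ i, ∃ t : ℝ, l i ≤ t ∧ t ≤ u i ∧ ∀ g : ℝ,
      |g - fderiv ℝ f c (Pi.single i 1)| ≤ K →
      M i * r i - 2 * K * r i ≤ σ * ((t - c i) * g) := by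
    intro i
    have h0 := hM i
    have hri := hr i
    rw [hl, hu]
    have gen : ∀ s : ℝ, (s = 1 ∨ s = -1) →
        σ * s * fderiv ℝ f c (Pi.single i 1) = |fderiv ℝ f c (Pi.single i 1)| →
        ∃ t : ℝ, c i - r i ≤ t ∧ t ≤ c i + r i ∧ ∀ g : ℝ,
          |g - fderiv ℝ f c (Pi.single i 1)| ≤ K →
          M i * r i - 2 * K * r i ≤ σ * ((t - c i) * g) := by
      intro s hs he
      refine ⟨c i + s * r i, ?_, ?_, ?_⟩
      · rcases hs with rfl | rfl <;> linarith
      · rcases hs with rfl | rfl <;> linarith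
      · intro g hg
        have h3 := abs_le.mp hg
        have h4 : |fderiv ℝ f c (Pi.single i 1)| - K ≤ σ * s * g := by
          rw [← he]
          rcases hs with rfl | rfl <;> rcases hσ with rfl | rfl <;> linarith
        have h5 : (M i - 2 * K) * r i ≤ (σ * s * g) * r i :=
          mul_le_mul_of_nonneg_right (by linarith) hri
        have h6 : σ * ((c i + s * r i - c i) * g) = (σ * s * g) * r i := by ring
        rw [h6]
        linarith
    rcases abs_cases (fderiv ℝ f c (Pi.single i 1)) with ⟨h, _⟩ | ⟨h, _⟩ <;>
      rcases hσ with rfl | rfl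
    · exact gen 1 (by simp) (by rw [h]; ring)
    · exact gen (-1) (by simp) (by rw [h]; ring)
    · exact gen (-1) (by simp) (by rw [h]; ring)
    · exact gen 1 (by simp) (by rw [h]; ring)
  choose x h1 h2 h3 using key
  have hx : x ∈ Set.Icc l u := ⟨h1, h2⟩
  obtain ⟨z, hz, h⟩ := aux_mvt f hf _ (convex_Icc l u) x c hx hc
  refine ⟨x, hx, ?_⟩
  rw [h, Finset.mul_sum, ← Finset.sum_sub_distrib]
  exact Finset.sum_le_sum fun i _ => h3 i _ (hK i z hz)

theorem refinement_excess_width_mean_value_form_second_order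
    (n N : ℕ) (hn : 1 ≤ n) (hN : 1 ≤ N) (a b : Fin n → ℝ) (hab : ∀ i, a i ≤ b i)
    (w : ℝ) (hw : w = ⨆ i, (b i - a i))
    (f : (Fin n → ℝ) → ℝ) (hf : ContDiff ℝ 1 f) (L : ℝ)
    (hL : ∀ x ∈ Set.Icc a b, ∀ y ∈ Set.Icc a b, ∀ i,
      |fderiv ℝ f x (Pi.single i 1) - fderiv ℝ f y (Pi.single i 1)| ≤ L * ⨆ j, |x j - y j|)
    (c : (Fin n → Fin N) → Fin n → ℝ)
    (hc : ∀ j i, c j i = (uniformSubLo n N a b j i + uniformSubHi n N a b j i) / 2)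
    (r : Fin n → ℝ) (hr : ∀ i, r i = (b i - a i) / (2 * N))
    (M : (Fin n → Fin N) → Fin n → ℝ)
    (hM : ∀ j i, M j i = sSup ((fun x => |fderiv ℝ f x (Pi.single i 1)|) ''
      Set.Icc (uniformSubLo n N a b j) (uniformSubHi n N a b j)))
    (lo hi : (Fin n → Fin N) → ℝ)
    (hlo : ∀ j, lo j = f (c j) - ∑ i, M j i * r i)
    (hhi : ∀ j, hi j = f (c j) + ∑ i, M j i * r i) :
    (∀ x ∈ Set.Icc a b, (⨅ j, lo j) ≤ f x ∧ f x ≤ ⨆ j, hi j) ∧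
    ((⨆ j, hi j) - ⨅ j, lo j) - (sSup (f '' Set.Icc a b) - sInf (f '' Set.Icc a b))
      ≤ 2 * (n : ℝ) * L * (w / N) ^ 2 := by
  have hNpos : (0 : ℝ) < N := by exact_mod_cast hN
  haveI : Nonempty (Fin n) := ⟨⟨0, hn⟩⟩
  haveI : Nonempty (Fin N) := ⟨⟨0, hN⟩⟩
  have hwi : ∀ i, b i - a i ≤ w := fun i => by
    rw [hw]; exact le_ciSup (f := fun i => b i - a i) (Set.finite_range _).bddAbove i
  have hw0 : 0 ≤ w := (sub_nonneg.mpr (hab ⟨0, hn⟩)).trans (hwi _)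
  have haX : a ∈ Set.Icc a b := ⟨le_refl _, hab⟩
  have hbX : b ∈ Set.Icc a b := ⟨hab, le_refl _⟩
  have hLw : 0 ≤ L * w := by
    have h := (abs_nonneg _).trans (hL b hbX a haX ⟨0, hn⟩)
    have e : (⨆ j, |b j - a j|) = w := by
      rw [hw]; congr 1; ext j; exact abs_of_nonneg (sub_nonneg.mpr (hab j))
    rwa [e] at h
  have hr0 : ∀ i, 0 ≤ r i := fun i => by
    rw [hr]; exact div_nonneg (sub_nonneg.mpr (hab i)) (by positivity)
  have hrw : ∀ i, r i ≤ w / N / 2 := fun i => by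
    rw [hr, div_div, mul_comm (N : ℝ) 2]
    exact div_le_div_of_nonneg_right (hwi i) (by positivity)
  have hl : ∀ j i, uniformSubLo n N a b j i = c j i - r i := fun j i => by
    rw [hc, hr]; simp only [uniformSubLo, uniformSubHi]; field_simp; ring
  have hu : ∀ j i, uniformSubHi n N a b j i = c j i + r i := fun j i => by
    rw [hc, hr]; simp only [uniformSubLo, uniformSubHi]; field_simp; ring
  have hsub : ∀ j, Set.Icc (uniformSubLo n N a b j) (uniformSubHi n N a b j) ⊆ Set.Icc a b := by
    intro j
    refine Set.Icc_subset_Icc (fun i => ?_) (fun i => ?_)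
    · have : 0 ≤ ((j i : ℕ) : ℝ) * (b i - a i) / N :=
        div_nonneg (mul_nonneg (by positivity) (sub_nonneg.mpr (hab i))) hNpos.le
      simp only [uniformSubLo]; linarith
    · have h1 : (((j i : ℕ) : ℝ) + 1) ≤ N := by exact_mod_cast (j i).2
      have : (((j i : ℕ) : ℝ) + 1) * (b i - a i) / N ≤ b i - a i := by
        rw [div_le_iff₀ hNpos, mul_comm (b i - a i)]
        exact mul_le_mul_of_nonneg_right h1 (sub_nonneg.mpr (hab i))
      simp only [uniformSubHi]; linarith
  have hcm : ∀ j, c j ∈ Set.Icc (uniformSubLo n N a b j) (uniformSubHi n N a b j) := fun j =>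
    ⟨fun i => by rw [hl]; linarith [hr0 i], fun i => by rw [hu]; linarith [hr0 i]⟩
  have hcont : Continuous (fderiv ℝ f) := hf.continuous_fderiv (by norm_num)
  have hMle : ∀ j i, ∀ x ∈ Set.Icc (uniformSubLo n N a b j) (uniformSubHi n N a b j),
      |fderiv ℝ f x (Pi.single i 1)| ≤ M j i := by
    intro j i x hx
    rw [hM]
    have hg : Continuous (fun x => |fderiv ℝ f x (Pi.single i 1)|) :=
      (hcont.clm_apply continuous_const).abs
    exact le_csSup (isCompact_Icc.image hg).bddAbove ⟨x, hx, rfl⟩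
  have hK : ∀ j i, ∀ x ∈ Set.Icc (uniformSubLo n N a b j) (uniformSubHi n N a b j),
      |fderiv ℝ f x (Pi.single i 1) - fderiv ℝ f (c j) (Pi.single i 1)| ≤ L * (w / N / 2) := by
    intro j i x hx
    have h := hL x (hsub j hx) (c j) (hsub j (hcm j)) i
    have h1 : (⨆ k, |x k - c j k|) ≤ w / N / 2 := by
      refine ciSup_le fun k => ?_
      refine le_trans ?_ (hrw k)
      have h1 := hx.1 k
      have h2 := hx.2 k
      rw [hl] at h1
      rw [hu] at h2
      rw [abs_le]; constructor <;> linarith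
    rcases le_or_gt 0 L with h0 | h0
    · exact h.trans (mul_le_mul_of_nonneg_left h1 h0)
    · have hwz : w = 0 := by nlinarith
      refine h.trans ?_
      rw [hwz]
      have : 0 ≤ ⨆ k, |x k - c j k| := Real.iSup_nonneg fun k => abs_nonneg _
      simp only [zero_div, mul_zero]
      exact mul_nonpos_of_nonpos_of_nonneg h0.le this
  have hMup : ∀ j i, M j i ≤ |fderiv ℝ f (c j) (Pi.single i 1)| + L * (w / N / 2) := by
    intro j i
    rw [hM]
    refine csSup_le ⟨_, c j, hcm j, rfl⟩ ?_
    rintro _ ⟨x, hx, rfl⟩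
    have h := hK j i x hx
    have h2 := abs_sub_abs_le_abs_sub (fderiv ℝ f x (Pi.single i 1))
      (fderiv ℝ f (c j) (Pi.single i 1))
    simp only
    linarith
  have hKr : ∑ i, 2 * (L * (w / N / 2)) * r i ≤ (n : ℝ) * L * (w / N) ^ 2 := by
    have hK0 : 0 ≤ L * (w / N) := by
      rw [← mul_div_assoc]; exact div_nonneg hLw hNpos.le
    have hwN : 0 ≤ w / N := div_nonneg hw0 hNpos.le
    have : ∀ i ∈ Finset.univ, 2 * (L * (w / N / 2)) * r i ≤ L * (w / N) * (w / N) := by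
      intro i _
      have h1 : r i ≤ w / N := (hrw i).trans (by linarith)
      have := mul_le_mul_of_nonneg_left h1 hK0
      linarith
    refine (Finset.sum_le_sum this).trans ?_
    simp only [Finset.sum_const, Finset.card_univ, Fintype.card_fin, nsmul_eq_mul]
    apply le_of_eq; ring
  have hcomp := (isCompact_Icc (a := a) (b := b)).image hf.continuous
  constructor
  · intro x hx
    have hcov : ∀ i, ∃ k : Fin N, a i + ((k : ℕ) : ℝ) * (b i - a i) / N ≤ x i ∧
        x i ≤ a i + (((k : ℕ) : ℝ) + 1) * (b i - a i) / N := by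
      intro i
      obtain ⟨m, rfl⟩ : ∃ m, N = m + 1 := ⟨N - 1, by omega⟩
      obtain ⟨k, hk, h1, h2⟩ := aux_cover (a i) ((b i - a i) / ((m + 1 : ℕ) : ℝ)) (x i) (hx.1 i) m
        (by
          have e : ((m : ℝ) + 1) * ((b i - a i) / ((m + 1 : ℕ) : ℝ)) = b i - a i := by
            push_cast; field_simp
          rw [e]; linarith [hx.2 i])
      exact ⟨⟨k, hk⟩, by rw [mul_div_assoc]; exact h1, by rw [mul_div_assoc]; exact h2⟩
    choose j h1 h2 using hcov
    have h := aux_upper f hf _ _ (c j) r (M j) (hl j) (hu j) hr0 (hMle j) x ⟨h1, h2⟩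
    have h3 := abs_le.mp h
    constructor
    · refine (ciInf_le (Set.finite_range lo).bddBelow j).trans ?_
      rw [hlo]; linarith
    · refine le_trans ?_ (le_ciSup (Set.finite_range hi).bddAbove j)
      rw [hhi]; linarith
  · have hA : (⨆ j, hi j) ≤ sSup (f '' Set.Icc a b) + (n : ℝ) * L * (w / N) ^ 2 := by
      refine ciSup_le fun j => ?_
      obtain ⟨x, hx, h⟩ := aux_lower f hf _ _ (c j) r (M j) (hl j) (hu j) hr0 _ (hK j) (hMup j)
        1 (Or.inl rfl)
      have h5 := le_csSup hcomp.bddAbove ⟨x, hsub j hx, rfl⟩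
      rw [hhi]; linarith
    have hB : sInf (f '' Set.Icc a b) - (n : ℝ) * L * (w / N) ^ 2 ≤ ⨅ j, lo j := by
      refine le_ciInf fun j => ?_
      obtain ⟨x, hx, h⟩ := aux_lower f hf _ _ (c j) r (M j) (hl j) (hu j) hr0 _ (hK j) (hMup j)
        (-1) (Or.inr rfl)
      have h5 := csInf_le hcomp.bddBelow ⟨x, hsub j hx, rfl⟩
      rw [hlo]; linarith
    linarith
end

section
/- Let f : ℝ → ℝ be differentiable with derivative f' that is L-Lipschitz on [a, b] (a ≤ b), let N ≥ 1, h = (b − a)/N, and for j = 0, …, N−1 let I_j = [a + j·h, a + (j+1)·h] with midpoint c_j = a + (j + 1/2)·h and M_j = sup_{x ∈ I_j} |f'(x)|. Then the refinement of the Mean Value Forms, H = [min_j (f(c_j) − M_j·h/2), max_j (f(c_j) + M_j·h/2)], satisfies f([a,b]) ⊆ H, and its excess width obeys the second-order bound (max_j (f(c_j) + M_j·h/2) − min_j (f(c_j) − M_j·h/2)) − (sup_{[a,b]} f − inf_{[a,b]} f) ≤ 2·L·((b − a)/N)². -/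
lemma mvf_reach (g : ℝ → ℝ) (hg : Differentiable ℝ g) (c r K : ℝ) (hr : 0 ≤ r)
    (hK : ∀ x ∈ Set.Icc (c - r) (c + r), |deriv g x - deriv g c| ≤ K) :
    ∃ e ∈ Set.Icc (c - r) (c + r), g c + |deriv g c| * r ≤ g e + K * r := by
  have key : ∀ e ∈ Set.Icc (c - r) (c + r),
      |(g e - deriv g c * e) - (g c - deriv g c * c)| ≤ K * |e - c| := by
    intro e he
    have hd : ∀ x, HasDerivAt (fun x => g x - deriv g c * x) (deriv g x - deriv g c) x := by
      intro x
      have := (hg x).hasDerivAt.fun_sub ((hasDerivAt_id x).const_mul (deriv g c))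
      simpa using this
    have := Convex.norm_image_sub_le_of_norm_hasDerivWithin_le (C := K)
      (f := fun x => g x - deriv g c * x) (f' := fun x => deriv g x - deriv g c)
      (s := Set.Icc (c - r) (c + r)) (x := c) (y := e)
      (fun x _ => (hd x).hasDerivWithinAt) (fun x hx => by simpa using hK x hx)
      (convex_Icc _ _) ⟨by linarith, by linarith⟩ he
    simpa using this
  rcases le_total 0 (deriv g c) with h0 | h0
  · have he : c + r ∈ Set.Icc (c - r) (c + r) := ⟨by linarith, by linarith⟩
    refine ⟨c + r, he, ?_⟩
    have h1 := key _ he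
    rw [show c + r - c = r by ring, abs_of_nonneg hr] at h1
    have h2 := (abs_le.1 h1).1
    rw [abs_of_nonneg h0]
    linarith
  · have he : c - r ∈ Set.Icc (c - r) (c + r) := ⟨by linarith, by linarith⟩
    refine ⟨c - r, he, ?_⟩
    have h1 := key _ he
    rw [show c - r - c = -r by ring, abs_neg, abs_of_nonneg hr] at h1
    have h2 := (abs_le.1 h1).1
    rw [abs_of_nonpos h0]
    linarith

lemma mvf_cover (a b : ℝ) (hab : a ≤ b) (N : ℕ) (hN : 1 ≤ N) (h : ℝ) (hh : h = (b - a) / N)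
    (x : ℝ) (hx : x ∈ Set.Icc a b) :
    ∃ j : Fin N, x ∈ Set.Icc (a + ((j : ℕ) : ℝ) * h) (a + (((j : ℕ) : ℝ) + 1) * h) := by
  have hN0 : (0 : ℝ) < N := by exact_mod_cast hN
  have hNh : N * h = b - a := by rw [hh]; field_simp
  have h0 : 0 ≤ h := by rw [hh]; exact div_nonneg (by linarith) hN0.le
  obtain ⟨hx1, hx2⟩ := hx
  rcases h0.eq_or_lt with h0 | h0
  · refine ⟨⟨0, hN⟩, ?_⟩
    rw [← h0] at hNh ⊢
    constructor <;> simp <;> linarith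
  rcases hx2.eq_or_lt with hx2 | hx2
  · refine ⟨⟨N - 1, by omega⟩, ?_⟩
    have : ((N - 1 : ℕ) : ℝ) = N - 1 := by push_cast [hN]; ring
    constructor <;> simp only [this] <;> nlinarith
  · have hq : 0 ≤ (x - a) / h := div_nonneg (by linarith) h0.le
    have e : (x - a) / h * h = x - a := by field_simp
    refine ⟨⟨⌊(x - a) / h⌋₊, ?_⟩, ?_⟩
    · rw [Nat.floor_lt hq, div_lt_iff₀ h0]; linarith
    · have h1 := Nat.floor_le hq
      have h2 := (Nat.lt_floor_add_one ((x - a) / h)).le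
      have h3 := mul_le_mul_of_nonneg_right h1 h0.le
      have h4 := mul_le_mul_of_nonneg_right h2 h0.le
      constructor <;> simp only <;> linarith

theorem univariate_mean_value_form_refinement_second_order
    (f : ℝ → ℝ) (hf : Differentiable ℝ f) (a b : ℝ) (hab : a ≤ b) (L : ℝ)
    (hL : ∀ x ∈ Set.Icc a b, ∀ y ∈ Set.Icc a b, |deriv f x - deriv f y| ≤ L * |x - y|)
    (N : ℕ) (hN : 1 ≤ N) (h : ℝ) (hh : h = (b - a) / N)
    (c : Fin N → ℝ) (hc : ∀ j, c j = a + (((j : ℕ) : ℝ) + 1 / 2) * h)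
    (M : Fin N → ℝ)
    (hM : ∀ j, M j = sSup ((fun x => |deriv f x|) ''
      Set.Icc (a + ((j : ℕ) : ℝ) * h) (a + (((j : ℕ) : ℝ) + 1) * h))) :
    (∀ x ∈ Set.Icc a b,
      (⨅ j, (f (c j) - M j * h / 2)) ≤ f x ∧ f x ≤ ⨆ j, (f (c j) + M j * h / 2)) ∧
    ((⨆ j, (f (c j) + M j * h / 2)) - ⨅ j, (f (c j) - M j * h / 2)) -
        (sSup (f '' Set.Icc a b) - sInf (f '' Set.Icc a b))
      ≤ 2 * L * ((b - a) / N) ^ 2 := by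
  have hN0 : (0 : ℝ) < N := by exact_mod_cast hN
  have hNh : N * h = b - a := by rw [hh]; field_simp
  have h0 : 0 ≤ h := by rw [hh]; exact div_nonneg (by linarith) hN0.le
  haveI : Nonempty (Fin N) := ⟨⟨0, hN⟩⟩
  have hLh : 0 ≤ L * h := by
    have h1 := (abs_nonneg _).trans (hL b ⟨hab, le_rfl⟩ a ⟨le_rfl, hab⟩)
    rw [abs_of_nonneg (by linarith : (0 : ℝ) ≤ b - a)] at h1
    rw [hh, ← mul_div_assoc]
    exact div_nonneg h1 hN0.le
  have hI : ∀ j : Fin N, Set.Icc (a + ((j : ℕ) : ℝ) * h) (a + (((j : ℕ) : ℝ) + 1) * h)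
      = Set.Icc (c j - h / 2) (c j + h / 2) := by
    intro j
    rw [hc]
    congr 1 <;> ring
  have hsub : ∀ j : Fin N, Set.Icc (c j - h / 2) (c j + h / 2) ⊆ Set.Icc a b := by
    intro j
    rw [← hI]
    have hj : (((j : ℕ) : ℝ) + 1) ≤ N := by exact_mod_cast j.2
    have hj0 : (0 : ℝ) ≤ ((j : ℕ) : ℝ) := Nat.cast_nonneg _
    apply Set.Icc_subset_Icc
    · nlinarith
    · nlinarith
  have hcm : ∀ j : Fin N, c j ∈ Set.Icc (c j - h / 2) (c j + h / 2) :=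
    fun j => ⟨by linarith, by linarith⟩
  have hD : ∀ j : Fin N, ∀ x ∈ Set.Icc (c j - h / 2) (c j + h / 2),
      |deriv f x - deriv f (c j)| ≤ L * h / 2 := by
    intro j x hx
    have h1 := hL x (hsub j hx) (c j) (hsub j (hcm j))
    have h2 : |x - c j| ≤ h / 2 := abs_le.2 ⟨by linarith [hx.1], by linarith [hx.2]⟩
    rcases le_or_gt 0 L with hL0 | hL0
    · nlinarith
    · have h3 : h = 0 := by nlinarith
      have h4 : |x - c j| = 0 := le_antisymm (by linarith) (abs_nonneg _)
      rw [h4] at h1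
      rw [h3]
      linarith
  have hup : ∀ j : Fin N, ∀ x ∈ Set.Icc (c j - h / 2) (c j + h / 2),
      |deriv f x| ≤ |deriv f (c j)| + L * h / 2 := by
    intro j x hx
    have h1 := hD j x hx
    have h2 := abs_sub_abs_le_abs_sub (deriv f x) (deriv f (c j))
    linarith
  have hMle : ∀ j, M j ≤ |deriv f (c j)| + L * h / 2 := by
    intro j
    rw [hM, hI]
    apply csSup_le (Set.Nonempty.image _ ⟨c j, hcm j⟩)
    rintro _ ⟨x, hx, rfl⟩
    exact hup j x hx
  have hleM : ∀ j, ∀ x ∈ Set.Icc (c j - h / 2) (c j + h / 2), |deriv f x| ≤ M j := by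
    intro j x hx
    rw [hM, hI]
    refine le_csSup ⟨|deriv f (c j)| + L * h / 2, ?_⟩ ⟨x, hx, rfl⟩
    rintro _ ⟨x, hx, rfl⟩
    exact hup j x hx
  constructor
  · intro x hx
    obtain ⟨j, hj⟩ := mvf_cover a b hab N hN h hh x hx
    rw [hI] at hj
    have h1 := Convex.norm_image_sub_le_of_norm_deriv_le (𝕜 := ℝ) (f := f) (C := M j)
      (s := Set.Icc (c j - h / 2) (c j + h / 2)) (x := c j) (y := x)
      (fun x _ => hf x) (fun x hx => by simpa using hleM j x hx)
      (convex_Icc _ _) (hcm j) hj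
    rw [Real.norm_eq_abs, Real.norm_eq_abs] at h1
    have h2 : |x - c j| ≤ h / 2 := abs_le.2 ⟨by linarith [hj.1], by linarith [hj.2]⟩
    have hM0 : 0 ≤ M j := (abs_nonneg _).trans (hleM j _ (hcm j))
    have h3 := abs_le.1 (h1.trans (mul_le_mul_of_nonneg_left h2 hM0))
    constructor
    · exact (ciInf_le (Set.finite_range _).bddBelow j).trans (by linarith [h3.1])
    · exact le_trans (by linarith [h3.2])
        (le_ciSup (f := fun j => f (c j) + M j * h / 2) (Set.finite_range _).bddAbove j)
  · have hcomp : IsCompact (f '' Set.Icc a b) := isCompact_Icc.image hf.continuous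
    have hS : (⨆ j, (f (c j) + M j * h / 2)) ≤ sSup (f '' Set.Icc a b) + L * h * h / 2 := by
      apply ciSup_le
      intro j
      obtain ⟨e, he, h1⟩ := mvf_reach f hf (c j) (h / 2) (L * h / 2) (by linarith) (hD j)
      have h2 := le_csSup hcomp.bddAbove (Set.mem_image_of_mem f (hsub j he))
      have h3 := mul_le_mul_of_nonneg_right (hMle j) h0
      linarith
    have hJ : sInf (f '' Set.Icc a b) - L * h * h / 2 ≤ ⨅ j, (f (c j) - M j * h / 2) := by
      apply le_ciInf
      intro j
      have hdn : ∀ x, deriv (fun y => - f y) x = - deriv f x := fun x => deriv.fun_neg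
      obtain ⟨e, he, h1⟩ := mvf_reach (fun y => - f y) hf.fun_neg (c j) (h / 2) (L * h / 2)
        (by linarith) (by
          intro x hx
          rw [hdn, hdn, ← abs_neg]
          have := hD j x hx
          convert this using 2
          ring)
      rw [hdn, abs_neg] at h1
      have h2 := csInf_le hcomp.bddBelow (Set.mem_image_of_mem f (hsub j he))
      have h3 := mul_le_mul_of_nonneg_right (hMle j) h0
      linarith
    rw [← hh]
    have h5 : 0 ≤ L * h * h := mul_nonneg hLh h0
    nlinarith
end
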